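/- Let s ∈ (0,1), m > 0, and let g be nonnegative, radially non-increasing, and symmetric. If E ⊆ ℝ^N is a minimizer of ℰ_{s,g} = P_s + V_g among sets of volume m, then E is essentially bounded: there exists R̂ > 0 with |E \ B_{R̂}(0)| = 0. -/

import Mathlib

open MeasureTheory ENNReal Set

noncomputable def fracKer (N : ℕ) (s : ℝ) (x : EuclideanSpace ℝ (Fin N)) : ℝ≥0∞ :=
  ENNReal.ofReal (‖x‖ ^ (-((N : ℝ) + s)))

noncomputable def fracPer (N : ℕ) (s : ℝ) (E : Set (EuclideanSpace ℝ (Fin N))) : ℝ≥0∞ :=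
  ∫⁻ x in E, ∫⁻ y in Eᶜ, fracKer N s (x - y)

noncomputable def rieszPot (N : ℕ) (g : EuclideanSpace ℝ (Fin N) → ℝ)
    (E : Set (EuclideanSpace ℝ (Fin N))) : ℝ≥0∞ :=
  ∫⁻ x in E, ∫⁻ y in E, ENNReal.ofReal (g (x - y))

noncomputable def fracInter (N : ℕ) (s : ℝ) (A B : Set (EuclideanSpace ℝ (Fin N))) : ℝ≥0∞ :=
  ∫⁻ x in A, ∫⁻ y in B, fracKer N s (x - y)

section Kernel

variable {N : ℕ} {s : ℝ}

lemma measurable_fracKer : Measurable (fracKer N s) := by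
  unfold fracKer
  fun_prop

lemma fracKer_neg (x : EuclideanSpace ℝ (Fin N)) : fracKer N s (-x) = fracKer N s x := by
  simp [fracKer]

lemma fracInter_comm (A B : Set (EuclideanSpace ℝ (Fin N))) :
    fracInter N s A B = fracInter N s B A := by
  unfold fracInter
  rw [lintegral_lintegral_swap]
  · refine lintegral_congr fun x => lintegral_congr fun y => ?_
    rw [← fracKer_neg, neg_sub]
  · exact (measurable_fracKer.comp (measurable_fst.sub measurable_snd)).aemeasurable

lemma fracInter_add_diff_left {A T : Set (EuclideanSpace ℝ (Fin N))}
    (hT : MeasurableSet T) (B : Set (EuclideanSpace ℝ (Fin N))) :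
    fracInter N s (A ∩ T) B + fracInter N s (A \ T) B = fracInter N s A B :=
  lintegral_inter_add_sdiff _ _ hT

lemma fracInter_union_right {A B C : Set (EuclideanSpace ℝ (Fin N))}
    (hC : MeasurableSet C) (h : Disjoint B C) :
    fracInter N s A (B ∪ C) = fracInter N s A B + fracInter N s A C := by
  rw [fracInter_comm, fracInter_comm A B, fracInter_comm A C]
  exact lintegral_union hC h

lemma fracPer_inter_add_fracPer_diff {E T : Set (EuclideanSpace ℝ (Fin N))}
    (hE : MeasurableSet E) (hT : MeasurableSet T) :
    fracPer N s (E ∩ T) + fracPer N s (E \ T)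
      = fracPer N s E + 2 * fracInter N s (E ∩ T) (E \ T) := by
  have h1 : fracPer N s (E ∩ T)
      = fracInter N s (E ∩ T) Eᶜ + fracInter N s (E ∩ T) (E \ T) := by
    rw [← fracInter_union_right (hE.diff hT) (disjoint_compl_left.mono_right sdiff_subset)]
    have : (E ∩ T)ᶜ = Eᶜ ∪ E \ T := by ext x; simp; tauto
    rw [← this]; rfl
  have h2 : fracPer N s (E \ T)
      = fracInter N s (E \ T) Eᶜ + fracInter N s (E ∩ T) (E \ T) := by
    rw [fracInter_comm (E ∩ T), ← fracInter_union_right (hE.inter hT)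
      (disjoint_compl_left.mono_right inter_subset_left)]
    have : (E \ T)ᶜ = Eᶜ ∪ E ∩ T := by ext x; simp; tauto
    rw [← this]; rfl
  have h3 : fracPer N s E = fracInter N s (E ∩ T) Eᶜ + fracInter N s (E \ T) Eᶜ :=
    (fracInter_add_diff_left hT Eᶜ).symm
  rw [h1, h2, h3]
  ring

lemma lintegral_min_mul_fracKer_lt_top (hN : 0 < N) (hs : s ∈ Ioo (0 : ℝ) 1) :
    ∫⁻ h : EuclideanSpace ℝ (Fin N), ENNReal.ofReal (min 1 ‖h‖) * fracKer N s h < ∞ := by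
  have : Nonempty (Fin N) := ⟨⟨0, hN⟩⟩
  have key : Integrable (fun h : EuclideanSpace ℝ (Fin N) =>
      (fun t : ℝ => min 1 t * t ^ (-((N : ℝ) + s))) ‖h‖) volume := by
    rw [integrable_fun_norm_addHaar volume (f := fun t : ℝ => min 1 t * t ^ (-((N : ℝ) + s))),
      finrank_euclideanSpace_fin, ← Ioc_union_Ioi_eq_Ioi (zero_le_one (α := ℝ))]
    have hpow (t : ℝ) (ht : 0 < t) : t ^ (N - 1) = t ^ ((N : ℝ) - 1) := by
      rw [← Real.rpow_natCast, Nat.cast_sub hN, Nat.cast_one]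
    refine IntegrableOn.union ?_ ?_
    · have h1 : IntegrableOn (fun t : ℝ => t ^ (-s)) (Ioc 0 1) :=
        (intervalIntegrable_iff_integrableOn_Ioc_of_le zero_le_one).1
          (intervalIntegral.intervalIntegrable_rpow' (by linarith [hs.2]))
      refine h1.congr_fun (fun t ht => ?_) measurableSet_Ioc
      simp only [smul_eq_mul]
      rw [min_eq_right ht.2, hpow t ht.1, ← mul_assoc]
      nth_rewrite 3 [← Real.rpow_one t]
      rw [← Real.rpow_add ht.1, ← Real.rpow_add ht.1]
      congr 1; ring
    · have h1 : IntegrableOn (fun t : ℝ => t ^ (-1 - s)) (Ioi 1) :=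
        integrableOn_Ioi_rpow_of_lt (by linarith [hs.1]) one_pos
      refine h1.congr_fun (fun t ht => ?_) measurableSet_Ioi
      have ht1 : 1 < t := ht
      have ht0 : 0 < t := by linarith
      simp only [smul_eq_mul]
      rw [min_eq_left ht1.le, hpow t ht0, one_mul, ← Real.rpow_add ht0]
      congr 1; ring
  convert key.lintegral_lt_top using 2
  funext h
  rw [fracKer, ← ENNReal.ofReal_mul (by positivity)]

lemma lintegral_truncated_annulus_le {A B : Set (EuclideanSpace ℝ (Fin N))} {R δ : ℝ}
    (hδ : δ ≤ 1) :
    ∫⁻ r in Ioc R (R + δ), ∫⁻ x in A, ∫⁻ y in B,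
        (if ‖x‖ < r ∧ r ≤ ‖y‖ then fracKer N s (x - y) else 0)
      ≤ ∫⁻ x in A, ∫⁻ y in B, ENNReal.ofReal (min 1 ‖x - y‖) * fracKer N s (x - y) := by
  have hmeas : Measurable (fun p : (ℝ × EuclideanSpace ℝ (Fin N)) × EuclideanSpace ℝ (Fin N) =>
      if ‖p.1.2‖ < p.1.1 ∧ p.1.1 ≤ ‖p.2‖ then fracKer N s (p.1.2 - p.2) else 0) := by
    refine Measurable.ite ?_ (measurable_fracKer.comp (by fun_prop)) measurable_const
    have h1 : MeasurableSet {p : (ℝ × EuclideanSpace ℝ (Fin N)) × EuclideanSpace ℝ (Fin N) |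
        ‖p.1.2‖ < p.1.1} := measurableSet_lt (by fun_prop) (by fun_prop)
    have h2 : MeasurableSet {p : (ℝ × EuclideanSpace ℝ (Fin N)) × EuclideanSpace ℝ (Fin N) |
        p.1.1 ≤ ‖p.2‖} := measurableSet_le (by fun_prop) (by fun_prop)
    exact h1.inter h2
  rw [lintegral_lintegral_swap]
  swap
  · exact hmeas.lintegral_prod_right'.aemeasurable
  refine lintegral_mono fun x => ?_
  rw [lintegral_lintegral_swap]
  swap
  · have hg : Measurable (fun p : ℝ × EuclideanSpace ℝ (Fin N) => ((p.1, x), p.2)) := by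
      fun_prop
    exact (hmeas.comp hg).aemeasurable
  refine lintegral_mono fun y => ?_
  calc ∫⁻ r in Ioc R (R + δ), (if ‖x‖ < r ∧ r ≤ ‖y‖ then fracKer N s (x - y) else 0)
      = ∫⁻ r in Ioc R (R + δ), (Ioc ‖x‖ ‖y‖).indicator (fun _ => fracKer N s (x - y)) r := by
        refine lintegral_congr fun r => ?_
        simp [indicator]
    _ = fracKer N s (x - y) * volume (Ioc ‖x‖ ‖y‖ ∩ Ioc R (R + δ)) := by
        rw [lintegral_indicator_const measurableSet_Ioc,
          Measure.restrict_apply measurableSet_Ioc]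
    _ ≤ ENNReal.ofReal (min 1 ‖x - y‖) * fracKer N s (x - y) := by
        rw [mul_comm]
        gcongr
        rw [ENNReal.ofReal_min]
        refine le_min ((measure_mono inter_subset_right).trans ?_)
          ((measure_mono inter_subset_left).trans ?_)
        · rw [Real.volume_Ioc]
          exact ENNReal.ofReal_le_ofReal (by linarith)
        · rw [Real.volume_Ioc]
          refine ENNReal.ofReal_le_ofReal ?_
          rw [norm_sub_rev]
          exact norm_sub_norm_le y x

lemma setLIntegral_truncated_eq (A : Set (EuclideanSpace ℝ (Fin N))) :
    ∫⁻ x in A, ∫⁻ y, ENNReal.ofReal (min 1 ‖x - y‖) * fracKer N s (x - y)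
      = (∫⁻ h : EuclideanSpace ℝ (Fin N), ENNReal.ofReal (min 1 ‖h‖) * fracKer N s h)
        * volume A := by
  have (x : EuclideanSpace ℝ (Fin N)) :
      ∫⁻ y, ENNReal.ofReal (min 1 ‖x - y‖) * fracKer N s (x - y)
        = ∫⁻ h : EuclideanSpace ℝ (Fin N), ENNReal.ofReal (min 1 ‖h‖) * fracKer N s h :=
    lintegral_sub_left_eq_self
      (fun h : EuclideanSpace ℝ (Fin N) => ENNReal.ofReal (min 1 ‖h‖) * fracKer N s h) x
  simp_rw [this]
  simp

lemma lintegral_fracInter_ball_le {E : Set (EuclideanSpace ℝ (Fin N))} (hE : MeasurableSet E)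
    {R δ : ℝ} (hδ : δ ≤ 1) :
    ∫⁻ r in Ioc R (R + δ), fracInter N s (E ∩ Metric.ball 0 r) (E \ Metric.ball 0 r)
      ≤ (∫⁻ h : EuclideanSpace ℝ (Fin N), ENNReal.ofReal (min 1 ‖h‖) * fracKer N s h)
        * volume (E \ Metric.ball 0 R) := by
  rw [← setLIntegral_truncated_eq]
  calc _ ≤ ∫⁻ r in Ioc R (R + δ), ∫⁻ x in univ, ∫⁻ y in E \ Metric.ball 0 R,
        (if ‖x‖ < r ∧ r ≤ ‖y‖ then fracKer N s (x - y) else 0) := by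
        refine setLIntegral_mono' measurableSet_Ioc fun r hr => ?_
        calc _ = ∫⁻ x in E ∩ Metric.ball 0 r, ∫⁻ y in E \ Metric.ball 0 r,
              (if ‖x‖ < r ∧ r ≤ ‖y‖ then fracKer N s (x - y) else 0) := by
              refine setLIntegral_congr_fun (hE.inter measurableSet_ball) fun x hx => ?_
              refine setLIntegral_congr_fun (hE.diff measurableSet_ball) fun y hy => ?_
              have h1 : ‖x‖ < r := by simpa using hx.2
              have h2 : r ≤ ‖y‖ := by simpa using hy.2
              simp [h1, h2]
          _ ≤ _ := by
              refine (lintegral_mono fun x => ?_).trans (lintegral_mono_set (subset_univ _))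
              exact lintegral_mono_set (sdiff_subset_sdiff_right (Metric.ball_subset_ball hr.1.le))
    _ ≤ ∫⁻ x in univ, ∫⁻ y in E \ Metric.ball 0 R,
          ENNReal.ofReal (min 1 ‖x - y‖) * fracKer N s (x - y) :=
        lintegral_truncated_annulus_le hδ
    _ = _ := by
        rw [lintegral_lintegral_swap]
        · rw [Measure.restrict_univ]
          refine lintegral_congr fun x => lintegral_congr fun y => ?_
          rw [← fracKer_neg, norm_sub_rev, neg_sub]
        · refine Measurable.aemeasurable ?_
          have := measurable_fracKer (N := N) (s := s)
          fun_prop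

lemma exists_fracPer_ball_lt_top (hN : 0 < N) (hs : s ∈ Ioo (0 : ℝ) 1) :
    ∃ r : ℝ, 0 < r ∧ fracPer N s (Metric.ball 0 r) < ∞ := by
  by_contra! hcon
  have hle : ∫⁻ r in Ioc (1 : ℝ) (1 + 1), fracPer N s (Metric.ball 0 r)
      ≤ (∫⁻ h : EuclideanSpace ℝ (Fin N), ENNReal.ofReal (min 1 ‖h‖) * fracKer N s h)
        * volume (Metric.ball (0 : EuclideanSpace ℝ (Fin N)) (1 + 1)) := by
    rw [← setLIntegral_truncated_eq]
    calc _ ≤ ∫⁻ r in Ioc (1 : ℝ) (1 + 1), ∫⁻ x in Metric.ball 0 (1 + 1), ∫⁻ y in univ,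
          (if ‖x‖ < r ∧ r ≤ ‖y‖ then fracKer N s (x - y) else 0) := by
          refine setLIntegral_mono' measurableSet_Ioc fun r hr => ?_
          calc _ = ∫⁻ x in Metric.ball 0 r, ∫⁻ y in (Metric.ball 0 r)ᶜ,
                (if ‖x‖ < r ∧ r ≤ ‖y‖ then fracKer N s (x - y) else 0) := by
                refine setLIntegral_congr_fun measurableSet_ball fun x hx => ?_
                refine setLIntegral_congr_fun measurableSet_ball.compl fun y hy => ?_
                have h1 : ‖x‖ < r := by simpa using hx
                have h2 : r ≤ ‖y‖ := by simpa using hy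
                simp [h1, h2]
            _ ≤ _ := by
                refine (lintegral_mono fun x => ?_).trans
                  (lintegral_mono_set (Metric.ball_subset_ball hr.2))
                exact lintegral_mono_set (subset_univ _)
      _ ≤ _ := lintegral_truncated_annulus_le le_rfl
      _ = _ := by simp only [Measure.restrict_univ]
  have hfin := hle.trans_lt
    (ENNReal.mul_lt_top (lintegral_min_mul_fracKer_lt_top hN hs) measure_ball_lt_top)
  have htop : ∫⁻ r in Ioc (1 : ℝ) (1 + 1), fracPer N s (Metric.ball 0 r)
      = ∫⁻ r in Ioc (1 : ℝ) (1 + 1), ∞ :=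
    setLIntegral_congr_fun measurableSet_Ioc fun r hr =>
      top_le_iff.1 (hcon r (by linarith [hr.1]))
  rw [htop] at hfin
  simp at hfin

lemma le_fracPer {A : Set (EuclideanSpace ℝ (Fin N))} (hA : MeasurableSet A) (hs : 0 < s)
    {ρ : ℝ} (h : 2 * volume A ≤ volume (Metric.ball (0 : EuclideanSpace ℝ (Fin N)) ρ)) :
    ENNReal.ofReal (ρ ^ (-((N : ℝ) + s)))
        * (volume (Metric.ball (0 : EuclideanSpace ℝ (Fin N)) ρ) / 2) * volume A
      ≤ fracPer N s A := by
  set b := volume (Metric.ball (0 : EuclideanSpace ℝ (Fin N)) ρ) with hb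
  have hb_top : b ≠ ∞ := measure_ball_lt_top.ne
  rw [← setLIntegral_const]
  refine setLIntegral_mono' hA fun x hx => ?_
  have hvol : b / 2 ≤ volume (Metric.ball x ρ \ A) := by
    have h1 : b ≤ volume (Metric.ball x ρ \ A) + volume A := by
      rw [hb, ← Measure.addHaar_ball_center volume x ρ]
      refine (measure_mono ?_).trans (measure_union_le _ _)
      intro y hy
      by_cases hyA : y ∈ A
      · exact Or.inr hyA
      · exact Or.inl ⟨hy, hyA⟩
    have h2 : volume A ≤ b / 2 := by
      rw [ENNReal.le_div_iff_mul_le (by simp) (by simp), mul_comm]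
      exact h
    have h3 : b / 2 + b / 2 ≤ volume (Metric.ball x ρ \ A) + b / 2 := by
      rw [ENNReal.add_halves]
      exact h1.trans (by gcongr)
    exact (ENNReal.add_le_add_iff_right (ENNReal.div_ne_top hb_top (by simp))).1 h3
  calc _ ≤ ENNReal.ofReal (ρ ^ (-((N : ℝ) + s))) * volume (Metric.ball x ρ \ A) := by gcongr
    _ = ∫⁻ y in Metric.ball x ρ \ A, ENNReal.ofReal (ρ ^ (-((N : ℝ) + s))) := by
        rw [setLIntegral_const]
    _ ≤ ∫⁻ y in Metric.ball x ρ \ A, fracKer N s (x - y) := by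
        refine setLIntegral_mono' (measurableSet_ball.diff hA) fun y hy => ?_
        have hxy : x ≠ y := fun h => hy.2 (h ▸ hx)
        refine ENNReal.ofReal_le_ofReal ?_
        refine Real.rpow_le_rpow_of_nonpos (norm_pos_iff.2 (sub_ne_zero.2 hxy)) ?_ ?_
        · rw [← dist_eq_norm, dist_comm]
          exact (Metric.mem_ball.1 hy.1).le
        · have : (0 : ℝ) ≤ N := Nat.cast_nonneg N
          linarith
    _ ≤ _ := lintegral_mono_set fun y hy => hy.2

end Kernel

section Scaling

open scoped Pointwise

variable {N : ℕ}

lemma setLIntegral_smul_set {c : ℝ} (hc : 0 < c) (A : Set (EuclideanSpace ℝ (Fin N)))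
    (f : EuclideanSpace ℝ (Fin N) → ℝ≥0∞) :
    ∫⁻ x in c • A, f x = ENNReal.ofReal (c ^ N) * ∫⁻ x in A, f (c • x) := by
  have hemb : MeasurableEmbedding (fun x : EuclideanSpace ℝ (Fin N) => c • x) :=
    measurableEmbedding_const_smul₀ hc.ne'
  have hpre : (fun x : EuclideanSpace ℝ (Fin N) => c • x) ⁻¹' (c • A) = A :=
    Set.preimage_image_eq A (smul_right_injective _ hc.ne')
  have h1 : ∫⁻ x in A, f (c • x) = ENNReal.ofReal ((c ^ N)⁻¹) * ∫⁻ x in c • A, f x := by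
    calc ∫⁻ x in A, f (c • x)
        = ∫⁻ x in c • A, f x ∂(Measure.map (fun x => c • x) volume) := by
          rw [hemb.restrict_map, hemb.lintegral_map, hpre]
      _ = _ := by
          rw [Measure.map_addHaar_smul volume hc.ne', finrank_euclideanSpace_fin,
            abs_of_pos (by positivity), Measure.restrict_smul, lintegral_smul_measure, smul_eq_mul]
  rw [h1, ← mul_assoc, ← ENNReal.ofReal_mul (by positivity), mul_inv_cancel₀ (by positivity),
    ENNReal.ofReal_one, one_mul]

lemma volume_smul_set {c : ℝ} (hc : 0 < c) (A : Set (EuclideanSpace ℝ (Fin N))) :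
    volume (c • A) = ENNReal.ofReal (c ^ N) * volume A := by
  rw [Measure.addHaar_smul, finrank_euclideanSpace_fin, abs_of_pos (by positivity)]

lemma fracKer_smul {s c : ℝ} (hc : 0 < c) (x : EuclideanSpace ℝ (Fin N)) :
    fracKer N s (c • x) = ENNReal.ofReal (c ^ (-((N : ℝ) + s))) * fracKer N s x := by
  rw [fracKer, fracKer, ← ENNReal.ofReal_mul (by positivity), norm_smul, Real.norm_eq_abs,
    abs_of_pos hc, Real.mul_rpow hc.le (norm_nonneg _)]

lemma fracPer_smul {s c : ℝ} (hc : 0 < c) (A : Set (EuclideanSpace ℝ (Fin N))) :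
    fracPer N s (c • A) = ENNReal.ofReal (c ^ N) * (ENNReal.ofReal (c ^ N) *
      (ENNReal.ofReal (c ^ (-((N : ℝ) + s))) * fracPer N s A)) := by
  have hcompl : c • Aᶜ = (c • A)ᶜ := image_compl_eq (MulAction.bijective₀ hc.ne')
  unfold fracPer
  rw [← hcompl, setLIntegral_smul_set hc]
  congr 1
  simp_rw [setLIntegral_smul_set hc, ← smul_sub, fracKer_smul hc,
    lintegral_const_mul' _ _ ENNReal.ofReal_ne_top]

lemma fracPer_smul_le {s c : ℝ} (hs : 0 < s) (hc : 1 ≤ c)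
    (A : Set (EuclideanSpace ℝ (Fin N))) :
    fracPer N s (c • A) ≤ ENNReal.ofReal ((c ^ N) ^ 2) * fracPer N s A := by
  rw [fracPer_smul (by linarith), pow_two, ENNReal.ofReal_mul (by positivity), mul_assoc]
  gcongr
  refine mul_le_of_le_one_left zero_le ?_
  rw [← ENNReal.ofReal_one]
  refine ENNReal.ofReal_le_ofReal (Real.rpow_le_one_of_one_le_of_nonpos hc ?_)
  have : (0 : ℝ) ≤ N := Nat.cast_nonneg N
  linarith

lemma rieszPot_smul_le {g : EuclideanSpace ℝ (Fin N) → ℝ}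
    (hg : ∀ x : EuclideanSpace ℝ (Fin N), x ≠ 0 → ∀ l : ℝ, 1 ≤ l → g (l • x) ≤ g x)
    {c : ℝ} (hc : 1 ≤ c) (A : Set (EuclideanSpace ℝ (Fin N))) :
    rieszPot N g (c • A) ≤ ENNReal.ofReal ((c ^ N) ^ 2) * rieszPot N g A := by
  have hc0 : 0 < c := by linarith
  unfold rieszPot
  rw [setLIntegral_smul_set hc0]
  simp_rw [setLIntegral_smul_set hc0, lintegral_const_mul' _ _ ENNReal.ofReal_ne_top, ← smul_sub]
  rw [pow_two, ENNReal.ofReal_mul (by positivity), mul_assoc]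
  gcongr with x y
  by_cases hxy : x - y = 0
  · simp [hxy]
  · exact hg _ hxy c hc

lemma rieszPot_mono (g : EuclideanSpace ℝ (Fin N) → ℝ) {A B : Set (EuclideanSpace ℝ (Fin N))}
    (h : A ⊆ B) : rieszPot N g A ≤ rieszPot N g B :=
  (lintegral_mono fun _ => lintegral_mono_set h).trans (lintegral_mono_set h)

lemma rieszPot_ball_lt_top {g : EuclideanSpace ℝ (Fin N) → ℝ}
    (hg : LocallyIntegrable g volume) (r : ℝ) :
    rieszPot N g (Metric.ball 0 r) < ∞ := by
  have hfin : ∫⁻ h in Metric.closedBall (0 : EuclideanSpace ℝ (Fin N)) (r + r),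
      ENNReal.ofReal (g h) < ∞ :=
    (hg.integrableOn_isCompact (isCompact_closedBall _ _)).lintegral_lt_top
  refine lt_of_le_of_lt ?_ (ENNReal.mul_lt_top hfin
    (measure_ball_lt_top (μ := volume) (x := (0 : EuclideanSpace ℝ (Fin N))) (r := r)))
  rw [← setLIntegral_const]
  refine setLIntegral_mono' measurableSet_ball fun x hx => ?_
  rw [← lintegral_indicator measurableSet_ball, ← lintegral_indicator measurableSet_closedBall,
    ← lintegral_sub_left_eq_self (indicator (Metric.closedBall _ _) _) x]
  refine lintegral_mono fun y => ?_
  by_cases hy : y ∈ Metric.ball (0 : EuclideanSpace ℝ (Fin N)) r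
  · have : x - y ∈ Metric.closedBall (0 : EuclideanSpace ℝ (Fin N)) (r + r) := by
      simp only [Metric.mem_ball, dist_zero_right, Metric.mem_closedBall] at *
      exact (norm_sub_le _ _).trans (by linarith)
    rw [indicator_of_mem hy, indicator_of_mem this]
  · rw [indicator_of_notMem hy]
    exact zero_le

lemma exists_finite_energy {s : ℝ} (hN : 0 < N) (hs : s ∈ Ioo (0 : ℝ) 1) {m : ℝ} (hm : 0 < m)
    {g : EuclideanSpace ℝ (Fin N) → ℝ} (hg : LocallyIntegrable g volume) :
    ∃ F : Set (EuclideanSpace ℝ (Fin N)), MeasurableSet F ∧ volume F = ENNReal.ofReal m ∧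
      fracPer N s F + rieszPot N g F < ∞ := by
  obtain ⟨r, hr, hP⟩ := exists_fracPer_ball_lt_top (N := N) hN hs
  set b := (volume (Metric.ball (0 : EuclideanSpace ℝ (Fin N)) r)).toReal with hb
  have hb_pos : 0 < b :=
    ENNReal.toReal_pos (Metric.measure_ball_pos volume _ hr).ne' measure_ball_lt_top.ne
  have hb_eq : volume (Metric.ball (0 : EuclideanSpace ℝ (Fin N)) r) = ENNReal.ofReal b :=
    (ENNReal.ofReal_toReal measure_ball_lt_top.ne).symm
  set c : ℝ := (m / b) ^ ((N : ℝ)⁻¹) with hc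
  have hc_pos : 0 < c := by positivity
  have hcN : c ^ N = m / b := Real.rpow_inv_natCast_pow (by positivity) hN.ne'
  refine ⟨c • Metric.ball 0 r, measurableSet_ball.const_smul₀ c, ?_, ?_⟩
  · rw [volume_smul_set hc_pos, hb_eq, ← ENNReal.ofReal_mul (by positivity), hcN,
      div_mul_cancel₀ _ hb_pos.ne']
  · refine ENNReal.add_lt_top.2 ⟨?_, ?_⟩
    · rw [fracPer_smul hc_pos]
      exact ENNReal.mul_lt_top ENNReal.ofReal_lt_top (ENNReal.mul_lt_top ENNReal.ofReal_lt_top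
        (ENNReal.mul_lt_top ENNReal.ofReal_lt_top hP))
    · rw [_root_.smul_ball hc_pos.ne', smul_zero]
      exact rieszPot_ball_lt_top hg _

end Scaling

section Minimizer

open scoped Pointwise

variable {N : ℕ}

lemma fracPer_diff_le_of_minimal {s : ℝ} (hN : 0 < N) (hs : s ∈ Ioo (0 : ℝ) 1) {m : ℝ}
    (hm : 0 < m) {g : EuclideanSpace ℝ (Fin N) → ℝ}
    (hgmono : ∀ x : EuclideanSpace ℝ (Fin N), x ≠ 0 → ∀ l : ℝ, 1 ≤ l → g (l • x) ≤ g x)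
    {E : Set (EuclideanSpace ℝ (Fin N))} (hE : MeasurableSet E)
    (hEvol : volume E = ENNReal.ofReal m)
    (hmin : ∀ F : Set (EuclideanSpace ℝ (Fin N)), MeasurableSet F →
      volume F = ENNReal.ofReal m →
        fracPer N s E + rieszPot N g E ≤ fracPer N s F + rieszPot N g F)
    (hfin : fracPer N s E + rieszPot N g E < ∞)
    {T : Set (EuclideanSpace ℝ (Fin N))} (hT : MeasurableSet T)
    (hvol : volume (E \ T) ≤ ENNReal.ofReal (m / 2)) :
    fracPer N s (E \ T) ≤ 8 * fracInter N s (E ∩ T) (E \ T)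
      + ENNReal.ofReal (8 * (fracPer N s E + rieszPot N g E).toReal / m) * volume (E \ T) := by
  by_cases hI : fracInter N s (E ∩ T) (E \ T) = ∞
  · simp [hI]
  obtain ⟨hP, hV⟩ := ENNReal.add_lt_top.1 hfin
  have hsplit := fracPer_inter_add_fracPer_diff (s := s) hE hT
  have hsum : fracPer N s (E ∩ T) + fracPer N s (E \ T) ≠ ∞ := by
    rw [hsplit]
    exact ENNReal.add_ne_top.2 ⟨hP.ne, ENNReal.mul_ne_top (by simp) hI⟩
  obtain ⟨hP1, hP2⟩ := ENNReal.add_ne_top.1 hsum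
  have hV1le : rieszPot N g (E ∩ T) ≤ rieszPot N g E := rieszPot_mono g inter_subset_left
  have hV1 : rieszPot N g (E ∩ T) ≠ ∞ := (hV1le.trans_lt hV).ne
  have hdtop : volume (E \ T) ≠ ∞ := (hvol.trans_lt ENNReal.ofReal_lt_top).ne
  have hvadd : volume (E ∩ T) + volume (E \ T) = ENNReal.ofReal m := by
    rw [measure_inter_add_sdiff _ hT, hEvol]
  have hitop : volume (E ∩ T) ≠ ∞ := fun h => by simp [h] at hvadd
  set d := (volume (E \ T)).toReal with hd
  set a := (volume (E ∩ T)).toReal with ha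
  have hd_le : d ≤ m / 2 := ENNReal.toReal_le_of_le_ofReal (by positivity) hvol
  have hd0 : 0 ≤ d := ENNReal.toReal_nonneg
  have had : a + d = m := by
    rw [ha, hd, ← ENNReal.toReal_add hitop hdtop, hvadd, ENNReal.toReal_ofReal hm.le]
  have ha_ge : m / 2 ≤ a := by linarith
  have ha_pos : 0 < a := by linarith
  set c : ℝ := (m / a) ^ ((N : ℝ)⁻¹) with hc
  have hma : 1 ≤ m / a := (one_le_div ha_pos).2 (by linarith)
  have hc1 : 1 ≤ c := Real.one_le_rpow hma (by positivity)
  have hcN : c ^ N = m / a := Real.rpow_inv_natCast_pow (by positivity) hN.ne'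
  have hcompare : fracPer N s E + rieszPot N g E ≤
      ENNReal.ofReal ((m / a) ^ 2) * (fracPer N s (E ∩ T) + rieszPot N g (E ∩ T)) := by
    refine (hmin (c • (E ∩ T)) ((hE.inter hT).const_smul₀ c) ?_).trans ?_
    · rw [volume_smul_set (by linarith), hcN, ← ENNReal.ofReal_toReal hitop, ← ha,
        ← ENNReal.ofReal_mul (by positivity), div_mul_cancel₀ _ ha_pos.ne']
    · rw [mul_add, ← hcN]
      exact add_le_add (fracPer_smul_le hs.1 hc1 _) (rieszPot_smul_le hgmono hc1 _)
  set e := (fracPer N s E + rieszPot N g E).toReal with he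
  set e₁ := (fracPer N s (E ∩ T) + rieszPot N g (E ∩ T)).toReal with he₁
  set p := (fracPer N s (E \ T)).toReal with hp
  set i := (fracInter N s (E ∩ T) (E \ T)).toReal with hi
  have he₁top : fracPer N s (E ∩ T) + rieszPot N g (E ∩ T) ≠ ∞ := ENNReal.add_ne_top.2 ⟨hP1, hV1⟩
  have hi0 : 0 ≤ i := ENNReal.toReal_nonneg
  have he0 : 0 ≤ e := ENNReal.toReal_nonneg
  have he₁0 : 0 ≤ e₁ := ENNReal.toReal_nonneg
  have hp0 : 0 ≤ p := ENNReal.toReal_nonneg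
  have hineq1 : e ≤ (m / a) ^ 2 * e₁ := by
    have := ENNReal.toReal_mono (ENNReal.mul_ne_top ENNReal.ofReal_ne_top he₁top) hcompare
    rwa [ENNReal.toReal_mul, ENNReal.toReal_ofReal (by positivity)] at this
  have hineq2 : e₁ + p ≤ e + 2 * i := by
    have h1 : fracPer N s (E ∩ T) + rieszPot N g (E ∩ T) + fracPer N s (E \ T)
        ≤ fracPer N s E + rieszPot N g E + 2 * fracInter N s (E ∩ T) (E \ T) := by
      rw [add_right_comm, hsplit, add_right_comm]
      gcongr
    have h2 := ENNReal.toReal_mono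
      (ENNReal.add_ne_top.2 ⟨hfin.ne, ENNReal.mul_ne_top (by simp) hI⟩) h1
    rwa [ENNReal.toReal_add he₁top hP2, ENNReal.toReal_add hfin.ne
      (ENNReal.mul_ne_top (by simp) hI), ENNReal.toReal_mul, ENNReal.toReal_ofNat] at h2
  have hL4 : (m / a) ^ 2 ≤ 4 := by
    have h1 : m / a ≤ 2 := (div_le_iff₀ ha_pos).2 (by linarith)
    nlinarith
  have hL1 : (m / a) ^ 2 - 1 ≤ 8 * d / m := by
    rw [div_pow, div_sub_one (by positivity), div_le_div_iff₀ (by positivity) hm]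
    have hd' : d = m - a := by linarith
    have h4 : m ^ 2 ≤ 4 * a ^ 2 := by nlinarith
    have h5 : (m + a) * m ≤ 8 * a ^ 2 := by nlinarith
    calc (m ^ 2 - a ^ 2) * m = d * ((m + a) * m) := by rw [hd']; ring
      _ ≤ d * (8 * a ^ 2) := by gcongr
      _ = _ := by ring
  have hL0 : 0 ≤ (m / a) ^ 2 - 1 := by nlinarith
  have hfinal : p ≤ 8 * i + 8 * e / m * d := by
    have h1 : ((m / a) ^ 2 - 1) * e₁ ≤ ((m / a) ^ 2 - 1) * (e + 2 * i) := by
      gcongr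
      linarith
    have h2 : ((m / a) ^ 2 - 1) * e ≤ 8 * d / m * e := by gcongr
    have h3 : ((m / a) ^ 2 - 1) * (2 * i) ≤ 3 * (2 * i) := by
      gcongr
      linarith
    have h4 : 8 * d / m * e = 8 * e / m * d := by ring
    linarith
  rw [← ENNReal.ofReal_toReal hP2, ← ENNReal.ofReal_toReal hI, ← ENNReal.ofReal_toReal hdtop,
    ← ENNReal.ofReal_ofNat 8, ← ENNReal.ofReal_mul (by positivity),
    ← ENNReal.ofReal_mul (by positivity), ← ENNReal.ofReal_add (by positivity) (by positivity)]
  exact ENNReal.ofReal_le_ofReal hfinal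

end Minimizer

lemma exists_eq_zero_of_decay {N : ℕ} (hN : 0 < N) {s ω C R₀ : ℝ} (hs : 0 < s)
    (hω : 0 < ω) (hC : 0 ≤ C) {f : ℝ → ℝ} (hf0 : ∀ r, 0 ≤ f r) (hf : Antitone f)
    (hlim : Filter.Tendsto f Filter.atTop (nhds 0))
    (hdecay : ∀ R ≥ R₀, ∀ δ ∈ Ioc (0 : ℝ) 1, ∀ ρ > 0, 2 * f R ≤ ω * ρ ^ N →
      δ * f (R + δ) * ω ≤ C * ρ ^ s * f R) :
    ∃ R > 0, f R = 0 := by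
  set t : ℝ := 2⁻¹ ^ s⁻¹ with ht
  have ht0 : 0 < t := by positivity
  have ht1 : t < 1 := Real.rpow_lt_one (by norm_num) (by norm_num) (by positivity)
  have hts : t ^ s = 2⁻¹ := Real.rpow_inv_rpow (by norm_num) hs.ne'
  obtain ⟨ρ₀, hρ₀, hρ₀le⟩ : ∃ ρ₀ > 0, 2 * C * ρ₀ ^ s ≤ t ^ N * ω := by
    have hq : 0 < t ^ N * ω / (2 * (C + 1)) := by positivity
    refine ⟨(t ^ N * ω / (2 * (C + 1))) ^ s⁻¹, by positivity, ?_⟩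
    rw [Real.rpow_inv_rpow hq.le hs.ne', ← mul_div_assoc, div_le_iff₀ (by positivity)]
    have : 0 ≤ t ^ N * ω := by positivity
    nlinarith
  obtain ⟨R₁, hR₁, hfR₁⟩ : ∃ R₁ ≥ max R₀ 1, 2 * f R₁ ≤ ω * ρ₀ ^ N := by
    have h1 : ∀ᶠ r in Filter.atTop, f r < ω * ρ₀ ^ N / 2 :=
      hlim.eventually_lt_const (by positivity)
    obtain ⟨r, hr, hr'⟩ := (h1.and (Filter.eventually_ge_atTop (max R₀ 1))).exists
    exact ⟨r, hr', by linarith⟩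
  have hR₁0 : R₀ ≤ R₁ := (le_max_left _ _).trans hR₁
  have hR₁1 : 1 ≤ R₁ := (le_max_right _ _).trans hR₁
  have hstep (k : ℕ) : 2 * f (R₁ + (1 - 2⁻¹ ^ k)) ≤ ω * (ρ₀ * t ^ k) ^ N := by
    induction k with
    | zero => simpa using hfR₁
    | succ k ih =>
      have hhalf : (0 : ℝ) < 2⁻¹ ^ k := by positivity
      have hhalf1 : (2⁻¹ : ℝ) ^ k ≤ 1 := pow_le_one₀ (by norm_num) (by norm_num)
      have h := hdecay (R₁ + (1 - 2⁻¹ ^ k)) (by linarith) (2⁻¹ ^ (k + 1))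
        ⟨by positivity, pow_le_one₀ (by norm_num) (by norm_num)⟩ (ρ₀ * t ^ k) (by positivity) ih
      have hR : R₁ + (1 - 2⁻¹ ^ k) + 2⁻¹ ^ (k + 1) = R₁ + (1 - (2⁻¹ : ℝ) ^ (k + 1)) := by
        rw [pow_succ]; ring
      have hρ : (ρ₀ * t ^ k) ^ s = ρ₀ ^ s * 2⁻¹ ^ k := by
        rw [Real.mul_rpow hρ₀.le (by positivity), ← Real.rpow_pow_comm ht0.le, hts]
      rw [hR, hρ] at h
      set u := f (R₁ + (1 - (2⁻¹ : ℝ) ^ (k + 1)))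
      set v := f (R₁ + (1 - (2⁻¹ : ℝ) ^ k)) with hv
      have hv0 : 0 ≤ v := hf0 _
      have h' : u * ω ≤ 2 * C * ρ₀ ^ s * v := by
        refine le_of_mul_le_mul_left ?_ hhalf
        rw [pow_succ] at h
        linarith
      have h'' : u * ω ≤ t ^ N * ω * v := h'.trans (by gcongr)
      have hu : u ≤ t ^ N * v := le_of_mul_le_mul_right (by linarith) hω
      calc 2 * u ≤ t ^ N * (2 * v) := by linarith
        _ ≤ t ^ N * (ω * (ρ₀ * t ^ k) ^ N) := by gcongr
        _ = ω * (ρ₀ * t ^ (k + 1)) ^ N := by rw [pow_succ, mul_pow, mul_pow, mul_pow]; ring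
  refine ⟨R₁ + 1, by linarith, le_antisymm ?_ (hf0 _)⟩
  have hlim0 : Filter.Tendsto (fun k : ℕ => ω * (ρ₀ * t ^ k) ^ N / 2) Filter.atTop (nhds 0) := by
    have h1 := tendsto_pow_atTop_nhds_zero_of_lt_one ht0.le ht1
    have h2 := ((((h1.const_mul ρ₀).pow N).const_mul ω).div_const 2)
    simpa [hN.ne'] using h2
  refine ge_of_tendsto' hlim0 fun k => ?_
  have hhalf : (0 : ℝ) < 2⁻¹ ^ k := by positivity
  have h1 : f (R₁ + 1) ≤ f (R₁ + (1 - 2⁻¹ ^ k)) := hf (by linarith)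
  linarith [hstep k]

/-- Boundedness of minimizers: if `g` is nonnegative, locally integrable,
radially non-increasing, symmetric, and `E` minimizes `ℰ_{s,g} = P_s + V_g` among
measurable sets of volume `m > 0`, then `E` is essentially bounded:
there is `R̂ > 0` with `|E \ B_{R̂}(0)| = 0`. -/
theorem minimizer_essentially_bounded (N : ℕ) (s : ℝ) (hs : s ∈ Set.Ioo (0:ℝ) 1)
    (m : ℝ) (hm : 0 < m)
    (g : EuclideanSpace ℝ (Fin N) → ℝ)
    (hg0 : ∀ x : EuclideanSpace ℝ (Fin N), x ≠ 0 → 0 ≤ g x)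
    (hgloc : LocallyIntegrable g volume)
    (hgmono : ∀ x : EuclideanSpace ℝ (Fin N), x ≠ 0 → ∀ l : ℝ, 1 ≤ l → g (l • x) ≤ g x)
    (hgsymm : ∀ x : EuclideanSpace ℝ (Fin N), x ≠ 0 → g (-x) = g x)
    (E : Set (EuclideanSpace ℝ (Fin N))) (hE : MeasurableSet E)
    (hEvol : volume E = ENNReal.ofReal m)
    (hmin : ∀ F : Set (EuclideanSpace ℝ (Fin N)), MeasurableSet F →
      volume F = ENNReal.ofReal m →
        fracPer N s E + rieszPot N g E ≤ fracPer N s F + rieszPot N g F) :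
    ∃ R : ℝ, 0 < R ∧ volume (E \ Metric.ball (0 : EuclideanSpace ℝ (Fin N)) R) = 0 := by
  rcases Nat.eq_zero_or_pos N with rfl | hN
  · refine ⟨1, one_pos, ?_⟩
    have : E \ Metric.ball (0 : EuclideanSpace ℝ (Fin 0)) 1 = ∅ := by
      ext x
      simp [Subsingleton.elim x 0]
    rw [this, measure_empty]
  obtain ⟨F, hF, hFvol, hFfin⟩ := exists_finite_energy hN hs hm hgloc
  have hfin : fracPer N s E + rieszPot N g E < ∞ := (hmin F hF hFvol).trans_lt hFfin
  have hEtop : volume E ≠ ∞ := by simp [hEvol]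
  have htop (r : ℝ) : volume (E \ Metric.ball 0 r) ≠ ∞ :=
    measure_ne_top_of_subset sdiff_subset hEtop
  set f : ℝ → ℝ := fun r => (volume (E \ Metric.ball 0 r)).toReal with hf_def
  have hfeq (r : ℝ) : volume (E \ Metric.ball 0 r) = ENNReal.ofReal (f r) :=
    (ENNReal.ofReal_toReal (htop r)).symm
  have hf0 (r : ℝ) : 0 ≤ f r := ENNReal.toReal_nonneg
  have hanti : Antitone fun r : ℝ => E \ Metric.ball (0 : EuclideanSpace ℝ (Fin N)) r :=
    fun r r' h => sdiff_subset_sdiff_right (Metric.ball_subset_ball h)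
  have hf : Antitone f := fun r r' h => ENNReal.toReal_mono (htop r) (measure_mono (hanti h))
  have hlim : Filter.Tendsto f Filter.atTop (nhds 0) := by
    have h1 := tendsto_measure_iInter_atTop (μ := volume)
      (fun r => (hE.diff (measurableSet_ball (x := (0 : EuclideanSpace ℝ (Fin N)))
        (ε := r))).nullMeasurableSet) hanti ⟨0, htop 0⟩
    have h2 : ⋂ r : ℝ, E \ Metric.ball (0 : EuclideanSpace ℝ (Fin N)) r = ∅ := by
      refine eq_empty_iff_forall_notMem.2 fun x hx => ?_
      exact (mem_iInter.1 hx (‖x‖ + 1)).2 (by simp)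
    rw [h2, measure_empty] at h1
    exact (ENNReal.tendsto_toReal ENNReal.zero_ne_top).comp h1
  obtain ⟨R₀, hR₀⟩ : ∃ R₀, ∀ R ≥ R₀, f R ≤ m / 2 :=
    Filter.eventually_atTop.1 (hlim.eventually_le_const (by positivity))
  set J := ∫⁻ h : EuclideanSpace ℝ (Fin N), ENNReal.ofReal (min 1 ‖h‖) * fracKer N s h with hJ
  have hJtop : J ≠ ∞ := (lintegral_min_mul_fracKer_lt_top hN hs).ne
  set D := 8 * (fracPer N s E + rieszPot N g E).toReal / m with hD
  have hD0 : 0 ≤ D := by positivity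
  set w := (volume (Metric.ball (0 : EuclideanSpace ℝ (Fin N)) 1)).toReal with hw
  have hw_pos : 0 < w :=
    ENNReal.toReal_pos (Metric.measure_ball_pos volume _ one_pos).ne' measure_ball_lt_top.ne
  have hball (ρ : ℝ) (hρ : 0 < ρ) :
      volume (Metric.ball (0 : EuclideanSpace ℝ (Fin N)) ρ) = ENNReal.ofReal (w * ρ ^ N) := by
    rw [Measure.addHaar_ball_of_pos volume _ hρ, finrank_euclideanSpace_fin, mul_comm w,
      ENNReal.ofReal_mul (by positivity), hw, ENNReal.ofReal_toReal measure_ball_lt_top.ne]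
  have hper (r : ℝ) (hr : R₀ ≤ r) : fracPer N s (E \ Metric.ball 0 r) ≤
      8 * fracInter N s (E ∩ Metric.ball 0 r) (E \ Metric.ball 0 r)
        + ENNReal.ofReal D * volume (E \ Metric.ball 0 r) :=
    fracPer_diff_le_of_minimal hN hs hm hgmono hE hEvol hmin hfin measurableSet_ball
      ((hfeq r).le.trans (ENNReal.ofReal_le_ofReal (hR₀ r hr)))
  obtain ⟨R, hR, hfR⟩ : ∃ R > 0, f R = 0 := by
    refine exists_eq_zero_of_decay hN (R₀ := R₀) (C := 2 * (8 * J.toReal + D)) hs.1 hw_pos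
      (by positivity) hf0 hf hlim fun R hR δ hδ ρ hρ hsmall => ?_
    have hupper : ∫⁻ r in Ioc R (R + δ), fracPer N s (E \ Metric.ball 0 r)
        ≤ ENNReal.ofReal ((8 * J.toReal + D) * f R) := by
      calc _ ≤ ∫⁻ r in Ioc R (R + δ),
            (8 * fracInter N s (E ∩ Metric.ball 0 r) (E \ Metric.ball 0 r)
              + ENNReal.ofReal (D * f R)) := by
            refine setLIntegral_mono' measurableSet_Ioc fun r hr => ?_
            refine (hper r (hR.trans hr.1.le)).trans ?_
            rw [ENNReal.ofReal_mul hD0, ← hfeq R]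
            gcongr
            exact hr.1.le
        _ = 8 * (∫⁻ r in Ioc R (R + δ),
              fracInter N s (E ∩ Metric.ball 0 r) (E \ Metric.ball 0 r))
              + ENNReal.ofReal (D * f R) * ENNReal.ofReal δ := by
            rw [lintegral_add_right _ measurable_const, lintegral_const_mul' _ _ (by simp),
              setLIntegral_const, Real.volume_Ioc, add_sub_cancel_left]
        _ ≤ 8 * (J * volume (E \ Metric.ball 0 R)) + ENNReal.ofReal (D * f R) * 1 := by
            gcongr
            · exact lintegral_fracInter_ball_le hE hδ.2
            · exact ENNReal.ofReal_le_one.2 hδ.2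
        _ = _ := by
            have hfR0 := hf0 R
            rw [hfeq R, ← ENNReal.ofReal_toReal hJtop, mul_one, ← ENNReal.ofReal_ofNat 8,
              ENNReal.toReal_ofReal ENNReal.toReal_nonneg,
              ← ENNReal.ofReal_mul (by positivity), ← ENNReal.ofReal_mul (by positivity),
              ← ENNReal.ofReal_add (by positivity) (by positivity)]
            congr 1
            ring
    have hlower : ENNReal.ofReal (ρ ^ (-((N : ℝ) + s)) * (w * ρ ^ N / 2) * f (R + δ) * δ)
        ≤ ∫⁻ r in Ioc R (R + δ), fracPer N s (E \ Metric.ball 0 r) := by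
      have hfR0 := hf0 (R + δ)
      calc _ = ∫⁻ r in Ioc R (R + δ),
            ENNReal.ofReal (ρ ^ (-((N : ℝ) + s)) * (w * ρ ^ N / 2) * f (R + δ)) := by
            rw [setLIntegral_const, Real.volume_Ioc, add_sub_cancel_left,
              ← ENNReal.ofReal_mul (by positivity)]
        _ ≤ _ := by
            refine setLIntegral_mono' measurableSet_Ioc fun r hr => ?_
            have hfr := hf0 r
            have hle : 2 * volume (E \ Metric.ball 0 r)
                ≤ volume (Metric.ball (0 : EuclideanSpace ℝ (Fin N)) ρ) := by
              rw [hball ρ hρ, hfeq r, ← ENNReal.ofReal_ofNat 2,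
                ← ENNReal.ofReal_mul (by positivity)]
              refine ENNReal.ofReal_le_ofReal (le_trans ?_ hsmall)
              have := hf hr.1.le
              linarith
            refine le_trans ?_ (le_fracPer (hE.diff measurableSet_ball) hs.1 hle)
            rw [hball ρ hρ, hfeq r, ENNReal.ofReal_mul (by positivity),
              ENNReal.ofReal_mul (by positivity), ENNReal.ofReal_div_of_pos (by positivity),
              ENNReal.ofReal_ofNat 2]
            gcongr
            exact hf hr.2
    have hreal := (ENNReal.ofReal_le_ofReal_iff (by have := hf0 R; positivity)).1
      (hlower.trans hupper)
    have hpow : ρ ^ (-((N : ℝ) + s)) * ρ ^ N * ρ ^ s = 1 := by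
      rw [← Real.rpow_natCast, ← Real.rpow_add hρ, ← Real.rpow_add hρ]
      rw [show -((N : ℝ) + s) + N + s = 0 by ring, Real.rpow_zero]
    have hmul := mul_le_mul_of_nonneg_right hreal (Real.rpow_nonneg hρ.le s)
    calc δ * f (R + δ) * w
        = δ * f (R + δ) * w * (ρ ^ (-((N : ℝ) + s)) * ρ ^ N * ρ ^ s) := by rw [hpow, mul_one]
      _ = 2 * (ρ ^ (-((N : ℝ) + s)) * (w * ρ ^ N / 2) * f (R + δ) * δ * ρ ^ s) := by ring
      _ ≤ 2 * ((8 * J.toReal + D) * f R * ρ ^ s) := by linarith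
      _ = _ := by ring
  exact ⟨R, hR, by rw [hfeq R, hfR, ENNReal.ofReal_zero]⟩
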